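/- (Mertens' first theorem) There exists a constant C > 0 such that for all integers n ≥ 2, |Σ_{p ≤ n, p prime} (log p)/p − log n| ≤ C. -/

import Mathlib

open Finset in
theorem log_factorial_eq_sum_factorization_mul_log (n : ℕ) :
    Real.log (n.factorial : ℝ) =
      ∑ p ∈ (Icc 1 n).filter Nat.Prime, (n.factorial.factorization p : ℝ) * Real.log p := by
  rw [Real.log_nat_eq_sum_factorization]
  apply Finsupp.sum_of_support_subset
  · intro p hp
    rw [Nat.support_factorization, Nat.mem_primeFactors] at hp
    simp only [mem_filter, mem_Icc]
    exact ⟨⟨hp.1.one_lt.le, (hp.1.dvd_factorial).mp hp.2.1⟩, hp.1⟩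
  · simp

theorem div_le_factorization_factorial {p : ℕ} (hp : p.Prime) (n : ℕ) :
    n / p ≤ n.factorial.factorization p := by
  calc n / p ≤ (p * (n / p)).factorial.factorization p := by
        rw [Nat.factorization_factorial_mul hp]
        exact Nat.le_add_left _ _
    _ ≤ n.factorial.factorization p :=
        (Nat.factorization_le_iff_dvd (Nat.factorial_ne_zero _) (Nat.factorial_ne_zero _)).mpr
          (Nat.factorial_dvd_factorial (Nat.mul_div_le n p)) p

theorem log_div_sub_one_le {p : ℕ} (hp : 2 ≤ p) :
    Real.log p / ((p : ℝ) - 1) ≤ Real.log p / p + 4 * (1 / (p : ℝ) ^ (3 / 2 : ℝ)) := by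
  have hp2 : (2 : ℝ) ≤ p := by exact_mod_cast hp
  have hp0 : (0 : ℝ) < p := by linarith
  have hlog : Real.log p ≤ (p : ℝ) ^ (1 / 2 : ℝ) / (1 / 2) :=
    Real.log_le_rpow_div hp0.le (by norm_num)
  have hpow : (p : ℝ) ^ (1 / 2 : ℝ) * (p : ℝ) ^ (3 / 2 : ℝ) = (p : ℝ) ^ 2 := by
    rw [← Real.rpow_add hp0, ← Real.rpow_natCast]
    norm_num
  have hpos : 0 < (p : ℝ) ^ (3 / 2 : ℝ) := Real.rpow_pos_of_pos hp0 _
  have hsub : Real.log p / ((p : ℝ) - 1) - Real.log p / p = Real.log p / (p * (p - 1)) := by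
    have : (p : ℝ) - 1 ≠ 0 := by linarith
    field_simp
    ring
  have hle : Real.log p / (p * (p - 1)) ≤ 4 * (1 / (p : ℝ) ^ (3 / 2 : ℝ)) := by
    rw [mul_one_div, div_le_div_iff₀ (by nlinarith) hpos]
    calc Real.log p * (p : ℝ) ^ (3 / 2 : ℝ)
        ≤ (p : ℝ) ^ (1 / 2 : ℝ) / (1 / 2) * (p : ℝ) ^ (3 / 2 : ℝ) := by gcongr
      _ = 2 * (p : ℝ) ^ 2 := by rw [← hpow]; ring
      _ ≤ 4 * (p * (p - 1)) := by nlinarith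
  linarith

open Finset in
theorem sum_log_div_prime_le {n : ℕ} (hn : 0 < n) :
    ∑ p ∈ (Icc 1 n).filter Nat.Prime, Real.log p / p ≤ Real.log n + Real.log 4 := by
  have hn0 : (0 : ℝ) < n := by exact_mod_cast hn
  have hfac : Real.log (n.factorial : ℝ) ≤ n * Real.log n := by
    rw [← Real.log_pow]
    exact Real.log_le_log (by exact_mod_cast n.factorial_pos)
      (by exact_mod_cast n.factorial_le_pow)
  have htheta : ∑ p ∈ (Icc 1 n).filter Nat.Prime, Real.log p ≤ Real.log 4 * n := by
    have h := Chebyshev.theta_le_log4_mul_x hn0.le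
    rwa [Chebyshev.theta, Nat.floor_natCast] at h
  have hsum : n * ∑ p ∈ (Icc 1 n).filter Nat.Prime, Real.log p / p
      ≤ Real.log (n.factorial : ℝ) + ∑ p ∈ (Icc 1 n).filter Nat.Prime, Real.log p := by
    rw [log_factorial_eq_sum_factorization_mul_log, ← sum_add_distrib, mul_sum]
    refine sum_le_sum fun p hp ↦ ?_
    have hp := (mem_filter.mp hp).2
    have h₁ : (n : ℝ) / p ≤ n.factorial.factorization p + 1 := by
      rw [div_le_iff₀ (by exact_mod_cast hp.pos)]
      have h := Nat.lt_mul_div_succ n hp.pos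
      have h' := Nat.mul_le_mul_left p
        (Nat.add_le_add_right (div_le_factorization_factorial hp n) 1)
      rw [mul_comm]
      exact_mod_cast h.le.trans h'
    calc n * (Real.log p / p) = n / p * Real.log p := by ring
      _ ≤ (n.factorial.factorization p + 1) * Real.log p :=
          mul_le_mul_of_nonneg_right h₁ (Real.log_natCast_nonneg p)
      _ = _ := by ring
  refine le_of_mul_le_mul_left ?_ hn0
  linarith

open Finset in
theorem log_le_sum_log_div_prime {n : ℕ} (hn : 0 < n) :
    Real.log n ≤ ∑ p ∈ (Icc 1 n).filter Nat.Prime, Real.log p / p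
      + (1 + 4 * ∑' k : ℕ, 1 / (k : ℝ) ^ (3 / 2 : ℝ)) := by
  have hn0 : (0 : ℝ) < n := by exact_mod_cast hn
  have hfac : n * Real.log n - n ≤ Real.log (n.factorial : ℝ) := by
    have h := Stirling.le_log_factorial_stirling hn.ne'
    have h₁ : 0 ≤ Real.log (2 * Real.pi) := Real.log_nonneg (by linarith [Real.pi_gt_three])
    linarith [Real.log_natCast_nonneg n]
  have htsum : ∑ p ∈ (Icc 1 n).filter Nat.Prime, 1 / (p : ℝ) ^ (3 / 2 : ℝ)
      ≤ ∑' k : ℕ, 1 / (k : ℝ) ^ (3 / 2 : ℝ) :=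
    (Real.summable_one_div_nat_rpow.mpr (by norm_num)).sum_le_tsum _ fun _ _ ↦ by positivity
  have hsum : Real.log (n.factorial : ℝ) ≤ n * (∑ p ∈ (Icc 1 n).filter Nat.Prime, Real.log p / p
      + 4 * ∑ p ∈ (Icc 1 n).filter Nat.Prime, 1 / (p : ℝ) ^ (3 / 2 : ℝ)) := by
    rw [log_factorial_eq_sum_factorization_mul_log, mul_sum, ← sum_add_distrib, mul_sum]
    refine sum_le_sum fun p hp ↦ ?_
    have hp := (mem_filter.mp hp).2
    have h₁ : (n.factorial.factorization p : ℝ) ≤ n / ((p : ℝ) - 1) := by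
      rw [← Nat.cast_pred hp.pos]
      exact (Nat.cast_le.mpr (Nat.factorization_factorial_le_div_pred hp n)).trans
        Nat.cast_div_le
    calc (n.factorial.factorization p : ℝ) * Real.log p
        ≤ n / ((p : ℝ) - 1) * Real.log p :=
          mul_le_mul_of_nonneg_right h₁ (Real.log_natCast_nonneg p)
      _ = n * (Real.log p / ((p : ℝ) - 1)) := by ring
      _ ≤ _ := mul_le_mul_of_nonneg_left (log_div_sub_one_le hp.two_le) hn0.le
  refine le_of_mul_le_mul_left ?_ hn0
  have := mul_le_mul_of_nonneg_left htsum hn0.le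
  linarith

/-- Mertens' first theorem: `∑_{p ≤ n} (log p)/p = log n + O(1)`. -/
theorem mertens_first :
    ∃ C : ℝ, 0 < C ∧ ∀ n : ℕ, 2 ≤ n →
      |(∑ p ∈ (Finset.Icc 1 n).filter Nat.Prime, Real.log p / p) - Real.log n| ≤ C := by
  have h4 : 0 ≤ Real.log 4 := Real.log_nonneg (by norm_num)
  have ht : 0 ≤ ∑' k : ℕ, 1 / (k : ℝ) ^ (3 / 2 : ℝ) := tsum_nonneg fun _ ↦ by positivity
  refine ⟨Real.log 4 + (1 + 4 * ∑' k : ℕ, 1 / (k : ℝ) ^ (3 / 2 : ℝ)), by positivity,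
    fun n hn ↦ abs_le.mpr ⟨?_, ?_⟩⟩
  · linarith [log_le_sum_log_div_prime (n := n) (by omega)]
  · linarith [sum_log_div_prime_le (n := n) (by omega)]
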